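/- arXiv:2210.00659 — 3 statements merged into one kernel-verified Lean document; each statement's English description precedes it below -/
import Mathlib

section
/- Let τ lie in the complex upper half-plane. Then 𝔭(τ)²·𝔭(2τ)² + 𝔭(τ)² − 2·𝔭(2τ) = 0. -/
/-- `qpow τ r = exp(2πi·r·τ)`, i.e. `q^r` where `q = exp(2πiτ)`. -/
noncomputable def qpow (τ : ℂ) (r : ℝ) : ℂ :=
  Complex.exp (2 * (Real.pi : ℂ) * Complex.I * (r : ℂ) * τ)

/-- `𝔭(τ) = 2 q^{1/16} ∏_{n≥1} ((1 + q^{n/2})/(1 + q^{n/2 - 1/4}))²`. -/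
noncomputable def pWeb (τ : ℂ) : ℂ :=
  2 * qpow τ (1/16) *
    ∏' n : ℕ, ((1 + qpow τ (((n : ℝ) + 1) / 2)) / (1 + qpow τ (((n : ℝ) + 1) / 2 - 1/4))) ^ 2

open Filter Topology Function

/-- The infinite product `∏ n, (1 + a * x ^ n)`, that is, the `q`-Pochhammer symbol `(-a; x)_∞`. -/
noncomputable def qProd (a x : ℂ) : ℂ := ∏' n : ℕ, (1 + a * x ^ n)

section qProd

variable {a x : ℂ}

lemma summable_norm_mul_pow (a : ℂ) (hx : ‖x‖ < 1) : Summable fun n : ℕ ↦ ‖a * x ^ n‖ := by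
  simpa using (summable_geometric_of_lt_one (norm_nonneg x) hx).mul_left ‖a‖

lemma hasProd_qProd (a : ℂ) (hx : ‖x‖ < 1) :
    HasProd (fun n : ℕ ↦ 1 + a * x ^ n) (qProd a x) :=
  (multipliable_one_add_of_summable (summable_norm_mul_pow a hx)).hasProd

lemma one_add_mul_pow_ne_zero (ha : ‖a‖ < 1) (hx : ‖x‖ < 1) (n : ℕ) : 1 + a * x ^ n ≠ 0 := by
  intro h
  have h1 : ‖a * x ^ n‖ = 1 := by
    rw [show a * x ^ n = -1 by linear_combination h]; simp
  rw [norm_mul, norm_pow] at h1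
  have h2 : ‖x‖ ^ n ≤ 1 := pow_le_one₀ (norm_nonneg x) hx.le
  nlinarith [norm_nonneg a, pow_nonneg (norm_nonneg x) n]

lemma qProd_ne_zero (ha : ‖a‖ < 1) (hx : ‖x‖ < 1) : qProd a x ≠ 0 :=
  tprod_one_add_ne_zero_of_summable (one_add_mul_pow_ne_zero ha hx) (summable_norm_mul_pow a hx)

lemma norm_sq_lt_one (hx : ‖x‖ < 1) : ‖x ^ 2‖ < 1 := by
  rw [norm_pow]; exact pow_lt_one₀ (norm_nonneg x) hx two_ne_zero

lemma qProd_eq_even_mul_odd (a : ℂ) (hx : ‖x‖ < 1) :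
    qProd a x = qProd a (x ^ 2) * qProd (a * x) (x ^ 2) := by
  refine (hasProd_qProd a hx).unique (HasProd.even_mul_odd ?_ ?_)
  · simpa only [pow_mul] using hasProd_qProd a (norm_sq_lt_one hx)
  · simpa only [pow_succ', pow_mul, mul_assoc, pow_zero, mul_one]
      using hasProd_qProd (a * x) (norm_sq_lt_one hx)

lemma qProd_neg_mul_qProd (a : ℂ) (hx : ‖x‖ < 1) :
    qProd (-a) x * qProd a x = qProd (-a ^ 2) (x ^ 2) := by
  refine ((hasProd_qProd _ hx).mul (hasProd_qProd _ hx)).unique ?_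
  convert hasProd_qProd (-a ^ 2) (norm_sq_lt_one hx) using 2 with n
  ring

lemma qProd_eq_one_add_mul (a : ℂ) (hx : ‖x‖ < 1) :
    qProd a x = (1 + a) * qProd (a * x) x := by
  refine (hasProd_qProd a hx).unique ?_
  simpa using HasProd.zero_mul (f := fun n : ℕ ↦ 1 + a * x ^ n)
    (by simpa only [pow_succ', mul_assoc] using hasProd_qProd (a * x) hx)

end qProd

section JacobiTripleProduct

variable {x y z : ℂ}

/-- The reciprocal `1 / ((1 - y) ⋯ (1 - y ^ m))`, extended by zero to negative `m`. -/
noncomputable def qFactorialInv (y : ℂ) (m : ℤ) : ℂ :=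
  if 0 ≤ m then (∏ i ∈ Finset.range m.toNat, (1 + -y * y ^ i))⁻¹ else 0

lemma qFactorialInv_sub_one (hy : ‖y‖ < 1) (m : ℤ) :
    qFactorialInv y (m - 1) = (1 - y ^ m) * qFactorialInv y m := by
  rcases lt_trichotomy m 0 with h | rfl | h
  · simp [qFactorialInv, show ¬ 0 ≤ m by lia, show ¬ 1 ≤ m by lia]
  · simp [qFactorialInv]
  · obtain ⟨n, rfl⟩ : ∃ n : ℕ, m = n + 1 := ⟨(m - 1).toNat, by lia⟩
    have h1 := one_add_mul_pow_ne_zero (a := -y) (by simpa using hy) hy n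
    have h2 : (1 : ℂ) - y ^ ((n : ℤ) + 1) = 1 + -y * y ^ n := by
      rw [show ((n : ℤ) + 1) = ((n + 1 : ℕ) : ℤ) by simp, zpow_natCast]; ring
    have h3 : ((n : ℤ) + 1).toNat = n + 1 := by lia
    simp only [qFactorialInv, h2, h3, add_sub_cancel_right, Int.toNat_natCast,
      Finset.prod_range_succ, mul_inv]
    rw [if_pos (by lia), if_pos (by lia), mul_left_comm, mul_inv_cancel₀ h1, mul_one]

lemma tendsto_qFactorialInv_natCast (hy : ‖y‖ < 1) :
    Tendsto (fun n : ℕ ↦ qFactorialInv y n) atTop (𝓝 (qProd (-y) y)⁻¹) := by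
  simpa [qFactorialInv] using
    (hasProd_qProd (-y) hy).tendsto_prod_nat.inv₀ (qProd_ne_zero (by simpa using hy) hy)

lemma tendsto_qFactorialInv (hy : ‖y‖ < 1) :
    Tendsto (qFactorialInv y) atTop (𝓝 (qProd (-y) y)⁻¹) := by
  have h : Tendsto Int.toNat atTop atTop :=
    tendsto_atTop.2 fun b ↦ (eventually_ge_atTop (b : ℤ)).mono fun m hm ↦ by lia
  refine ((tendsto_qFactorialInv_natCast hy).comp h).congr' ?_
  filter_upwards [eventually_ge_atTop (0 : ℤ)] with m hm
  simp [Int.toNat_of_nonneg hm]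

lemma exists_norm_qFactorialInv_le (hy : ‖y‖ < 1) : ∃ C, ∀ m, ‖qFactorialInv y m‖ ≤ C := by
  obtain ⟨C, hC⟩ := (Metric.isBounded_range_of_tendsto _
    (tendsto_qFactorialInv_natCast hy)).exists_norm_le
  have hC' (n : ℕ) : ‖qFactorialInv y n‖ ≤ C := hC _ ⟨n, rfl⟩
  refine ⟨C, fun m ↦ ?_⟩
  rcases le_or_gt 0 m with h | h
  · simpa [Int.toNat_of_nonneg h] using hC' m.toNat
  · simpa [qFactorialInv, not_le.2 h] using (norm_nonneg _).trans (hC' 0)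

/-- The theta term `x ^ (k ^ 2) * z ^ k`. -/
noncomputable def thetaTerm (x z : ℂ) (k : ℤ) : ℂ := x ^ (k * k) * z ^ k

lemma summable_thetaTerm (hx0 : x ≠ 0) (hx : ‖x‖ < 1) (hz : z ≠ 0) :
    Summable (thetaTerm x z) := by
  have hI : (Real.pi : ℂ) * Complex.I ≠ 0 := by simp [Real.pi_ne_zero]
  set τ : ℂ := Complex.log x / (Real.pi * Complex.I) with hτ
  set w : ℂ := Complex.log z / (2 * (Real.pi * Complex.I)) with hw
  have hτ' : Real.pi * Complex.I * τ = Complex.log x := by rw [hτ]; field_simp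
  have hw' : 2 * (Real.pi * Complex.I) * w = Complex.log z := by rw [hw]; field_simp
  have him : 0 < τ.im := by
    have h1 := congrArg Complex.re hτ'
    simp [Complex.log_re] at h1
    have h2 := Real.log_neg (norm_pos_iff.2 hx0) hx
    by_contra! h
    nlinarith [Real.pi_pos]
  refine ((summable_jacobiTheta₂_term_iff w τ).2 him).congr fun k ↦ ?_
  rw [thetaTerm, jacobiTheta₂_term, ← Complex.exp_log hx0, ← Complex.exp_log hz,
    ← Complex.exp_int_mul, ← Complex.exp_int_mul, ← Complex.exp_add,
    ← hτ', ← hw']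
  congr 1
  push_cast
  ring

/-- A finite form of the Jacobi triple product identity. -/
lemma hasSum_finite_tripleProduct (hx0 : x ≠ 0) (hx : ‖x‖ < 1) (hz : z ≠ 0) (N : ℕ) :
    HasSum (fun k : ℤ ↦ qFactorialInv (x ^ 2) (N + k) * qFactorialInv (x ^ 2) (N - k) *
        thetaTerm x z k)
      (qFactorialInv (x ^ 2) (2 * N) *
        ((∏ i ∈ Finset.range N, (1 + x * z * (x ^ 2) ^ i)) *
          ∏ i ∈ Finset.range N, (1 + x * z⁻¹ * (x ^ 2) ^ i))) := by
  have hy := norm_sq_lt_one hx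
  induction N with
  | zero =>
    convert hasSum_single (0 : ℤ) ?_ using 1
    · simp [qFactorialInv, thetaTerm]
    · intro k hk
      rcases lt_or_gt_of_ne hk with h | h <;> simp [qFactorialInv, h.not_ge]
  | succ N ih =>
    set y := x ^ 2 with hyx
    have hy0 : y ≠ 0 := pow_ne_zero 2 hx0
    set v := qFactorialInv y
    set p := y ^ N with hp
    have hstep (m : ℤ) : v (m - 1) = (1 - y ^ m) * v m := qFactorialInv_sub_one hy m
    have h1 : (1 : ℂ) - y * p ^ 2 ≠ 0 := by
      convert one_add_mul_pow_ne_zero (a := -y) (by simpa using hy) hy (2 * N) using 1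
      rw [hp]; ring
    have h2 : (1 : ℂ) - y ^ 2 * p ^ 2 ≠ 0 := by
      convert one_add_mul_pow_ne_zero (a := -y) (by simpa using hy) hy (2 * N + 1) using 1
      rw [hp]; ring
    have hv : v (2 * N) = (1 - y * p ^ 2) * (1 - y ^ 2 * p ^ 2) * v (2 * (N + 1 : ℕ)) := by
      rw [show (2 * N : ℤ) = 2 * (N + 1 : ℕ) - 1 - 1 by push_cast; ring, hstep, hstep,
        show (2 * (N + 1 : ℕ) - 1 : ℤ) = (2 * N + 1 : ℕ) by push_cast; ring,
        show (2 * (N + 1 : ℕ) : ℤ) = (2 * N + 2 : ℕ) by push_cast; ring,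
        zpow_natCast, zpow_natCast, hp]
      ring
    have hsum := (((ih.mul_left (1 + y * p ^ 2)).add
      (((Equiv.subRight (1 : ℤ)).hasSum_iff.2 ih).mul_left (x * p * z))).add
      (((Equiv.addRight (1 : ℤ)).hasSum_iff.2 ih).mul_left (x * p * z⁻¹))).mul_left
      ((1 - y * p ^ 2) * (1 - y ^ 2 * p ^ 2))⁻¹
    refine Eq.mpr (congrArg₂ (fun f s ↦ HasSum f s) (funext fun k ↦ ?_) ?_) hsum
    · rw [eq_inv_mul_iff_mul_eq₀ (mul_ne_zero h1 h2)]
      simp only [comp_apply, Equiv.subRight_apply, Equiv.coe_addRight]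
      have hγ : y ^ (N + 1 + k : ℤ) = y * y ^ (N + k : ℤ) := by
        rw [← zpow_one_add₀ hy0]; ring_nf
      have hδ : y ^ (N + 1 - k : ℤ) = y * y ^ (N - k : ℤ) := by
        rw [← zpow_one_add₀ hy0]; ring_nf
      have hγδ : y ^ (N + k : ℤ) * y ^ (N - k : ℤ) = p ^ 2 := by
        rw [← zpow_add₀ hy0, hp, ← pow_mul, ← zpow_natCast]
        push_cast
        ring_nf
      have hN : x * p = x ^ (2 * N + 1 : ℤ) := by
        rw [hp, hyx, ← pow_mul, ← pow_succ', ← zpow_natCast]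
        push_cast
        rfl
      have ht1 : x * p * z * thetaTerm x z (k - 1) = y * y ^ (N - k : ℤ) * thetaTerm x z k := by
        rw [← hδ, hN, thetaTerm, thetaTerm, hyx, ← zpow_natCast x 2, ← zpow_mul, zpow_sub_one₀ hz,
          ← mul_assoc (x ^ _) (x ^ (k * k)), ← zpow_add₀ hx0]
        have : x ^ (2 * N + 1 : ℤ) * x ^ ((k - 1) * (k - 1)) =
            x ^ (((2 : ℕ) : ℤ) * (N + 1 - k) + k * k) := by
          rw [← zpow_add₀ hx0]; push_cast; ring_nf
        rw [← this]
        field_simp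
      have ht2 : x * p * z⁻¹ * thetaTerm x z (k + 1) =
          y * y ^ (N + k : ℤ) * thetaTerm x z k := by
        rw [← hγ, hN, thetaTerm, thetaTerm, hyx, ← zpow_natCast x 2, ← zpow_mul, zpow_add_one₀ hz,
          ← mul_assoc (x ^ _) (x ^ (k * k)), ← zpow_add₀ hx0]
        have : x ^ (2 * N + 1 : ℤ) * x ^ ((k + 1) * (k + 1)) =
            x ^ (((2 : ℕ) : ℤ) * (N + 1 + k) + k * k) := by
          rw [← zpow_add₀ hx0]; push_cast; ring_nf
        rw [← this]
        field_simp
      have hA : v (N + k) = (1 - y * y ^ (N + k : ℤ)) * v (N + 1 + k) := by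
        rw [← hγ, ← hstep]; ring_nf
      have hB : v (N - k) = (1 - y * y ^ (N - k : ℤ)) * v (N + 1 - k) := by
        rw [← hδ, ← hstep]; ring_nf
      have hA' : v (N + (k - 1)) = (1 - y ^ (N + k : ℤ)) * v (N + k) := by
        rw [← hstep]; ring_nf
      have hB' : v (N - (k + 1)) = (1 - y ^ (N - k : ℤ)) * v (N - k) := by
        rw [← hstep]; ring_nf
      rw [hA', hB', hA, hB, show (N - (k - 1) : ℤ) = N + 1 - k by ring,
        show (N + (k + 1) : ℤ) = N + 1 + k by ring, Nat.cast_add_one, ← hγδ]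
      generalize y ^ (N + k : ℤ) = γ at *
      generalize y ^ (N - k : ℤ) = δ at *
      generalize v (N + 1 + k) = A at *
      generalize v (N + 1 - k) = B at *
      linear_combination (-(1 - γ) * (1 - y * γ) * A * B) * ht1 -
        ((1 - δ) * (1 - y * δ) * A * B) * ht2
    · rw [eq_inv_mul_iff_mul_eq₀ (mul_ne_zero h1 h2), hv, Finset.prod_range_succ,
        Finset.prod_range_succ, ← hp]
      have hpx : (1 + x * z * p) * (1 + x * z⁻¹ * p) =
          1 + y * p ^ 2 + x * p * z + x * p * z⁻¹ := by
        rw [hyx]; field_simp; ring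
      linear_combination (1 - y * p ^ 2) * (1 - y ^ 2 * p ^ 2) * v (2 * (N + 1 : ℕ)) *
        (∏ i ∈ Finset.range N, (1 + x * z * y ^ i)) *
        (∏ i ∈ Finset.range N, (1 + x * z⁻¹ * y ^ i)) * hpx

/-- The **Jacobi triple product identity**. -/
theorem tsum_thetaTerm (hx0 : x ≠ 0) (hx : ‖x‖ < 1) (hz : z ≠ 0) :
    ∑' k, thetaTerm x z k =
      qProd (-x ^ 2) (x ^ 2) * (qProd (x * z) (x ^ 2) * qProd (x * z⁻¹) (x ^ 2)) := by
  have hy := norm_sq_lt_one hx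
  set Q := qProd (-x ^ 2) (x ^ 2) with hQ
  have hQ0 : Q ≠ 0 := qProd_ne_zero (by simpa using hy) hy
  obtain ⟨C, hC⟩ := exists_norm_qFactorialInv_le hy
  have hC0 : 0 ≤ C := (norm_nonneg _).trans (hC 0)
  have hadd (k : ℤ) : Tendsto (fun N : ℕ ↦ (N : ℤ) + k) atTop atTop :=
    tendsto_atTop_add_const_right _ k tendsto_natCast_atTop_atTop
  have hv := tendsto_qFactorialInv hy
  have hlim : Tendsto (fun N : ℕ ↦ ∑' k : ℤ, qFactorialInv (x ^ 2) (N + k) *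
      qFactorialInv (x ^ 2) (N - k) * thetaTerm x z k) atTop
      (𝓝 (∑' k, Q⁻¹ * Q⁻¹ * thetaTerm x z k)) := by
    refine tendsto_tsum_of_dominated_convergence
      (bound := fun k ↦ C * C * ‖thetaTerm x z k‖)
      ((summable_thetaTerm hx0 hx hz).norm.mul_left _) (fun k ↦ ?_) (.of_forall fun N k ↦ ?_)
    · exact ((hv.comp (hadd k)).mul (hv.comp (hadd (-k)))).mul_const _
    · rw [norm_mul, norm_mul]
      gcongr <;> apply hC
  have htwo : Tendsto (fun N : ℕ ↦ 2 * (N : ℤ)) atTop atTop :=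
    tendsto_natCast_atTop_atTop.const_mul_atTop' two_pos
  have hlim' := (hv.comp htwo).mul ((hasProd_qProd (x * z) hy).tendsto_prod_nat.mul
    (hasProd_qProd (x * z⁻¹) hy).tendsto_prod_nat)
  have h := tendsto_nhds_unique hlim
    (hlim'.congr fun N ↦ (hasSum_finite_tripleProduct hx0 hx hz N).tsum_eq.symm)
  rw [tsum_mul_left, ← hQ] at h
  field_simp at h
  rw [h, div_eq_mul_inv, mul_assoc]

end JacobiTripleProduct

section ThetaDuplication

variable {x : ℂ}

lemma hasSum_of_hasSum_add_sub {M : Type*} [AddCommMonoid M] [TopologicalSpace M]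
    [ContinuousAdd M] {f : ℤ × ℤ → M} {s t : M}
    (hs : HasSum (fun p : ℤ × ℤ ↦ f (p.1 + p.2, p.1 - p.2)) s)
    (ht : HasSum (fun p : ℤ × ℤ ↦ f (p.1 + p.2 + 1, p.1 - p.2)) t) : HasSum f (s + t) := by
  have hi : Injective fun p : ℤ × ℤ ↦ (p.1 + p.2, p.1 - p.2) := by
    rintro ⟨a, b⟩ ⟨c, d⟩ h
    simp only [Prod.mk.injEq] at h ⊢
    lia
  have hj : Injective fun p : ℤ × ℤ ↦ (p.1 + p.2 + 1, p.1 - p.2) := by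
    rintro ⟨a, b⟩ ⟨c, d⟩ h
    simp only [Prod.mk.injEq] at h ⊢
    lia
  refine (hi.hasSum_range_iff.2 hs).add_isCompl ?_ (hj.hasSum_range_iff.2 ht)
  refine ⟨Set.disjoint_left.2 ?_, codisjoint_iff.2 ?_⟩
  · rintro _ ⟨⟨a, b⟩, rfl⟩ ⟨⟨c, d⟩, h⟩
    simp only [Prod.mk.injEq] at h
    lia
  · refine Set.eq_univ_of_forall fun ⟨m, n⟩ ↦ ?_
    rcases Int.even_or_odd' (m + n) with ⟨k, h | h⟩
    · exact .inl ⟨(k, m - k), Prod.ext (by simp) (by simp; lia)⟩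
    · exact .inr ⟨(k, m - 1 - k), Prod.ext (by simp) (by simp; lia)⟩

lemma hasSum_thetaTerm_mul (hx0 : x ≠ 0) (hx : ‖x‖ < 1) {z : ℂ} (hz : z ≠ 0) :
    HasSum (fun p : ℤ × ℤ ↦ thetaTerm x z p.1 * thetaTerm x z p.2)
      ((∑' k, thetaTerm x z k) ^ 2) := by
  have h := (summable_thetaTerm hx0 hx hz).norm
  rw [sq, tsum_mul_tsum_of_summable_norm h h]
  exact (summable_mul_of_summable_norm h h).hasSum

/-- The duplication formula `θ₃(x)² = θ₃(x²)² + θ₂(x²)²` for theta constants. -/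
lemma tsum_thetaTerm_sq (hx0 : x ≠ 0) (hx : ‖x‖ < 1) :
    (∑' k, thetaTerm x 1 k) ^ 2 =
      (∑' k, thetaTerm (x ^ 2) 1 k) ^ 2 + x * (∑' k, thetaTerm (x ^ 2) (x ^ 2) k) ^ 2 := by
  have hy := norm_sq_lt_one hx
  have hy0 := pow_ne_zero 2 hx0
  refine (hasSum_thetaTerm_mul hx0 hx one_ne_zero).unique (hasSum_of_hasSum_add_sub ?_ ?_)
  · convert hasSum_thetaTerm_mul hy0 hy one_ne_zero using 1
    funext p
    simp only [thetaTerm, one_zpow, mul_one, ← zpow_natCast, ← zpow_mul, ← zpow_add₀ hx0]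
    congr 1
    push_cast
    ring
  · refine Eq.mpr (congrArg (HasSum · _) (funext fun p ↦ ?_))
      ((hasSum_thetaTerm_mul hy0 hy hy0).mul_left x)
    simp only [thetaTerm, one_zpow, mul_one, ← zpow_natCast, ← zpow_mul, ← zpow_add₀ hx0,
      ← zpow_one_add₀ hx0]
    congr 1
    push_cast
    ring

lemma qProd_duplication (hx0 : x ≠ 0) (hx : ‖x‖ < 1) :
    qProd (x ^ 2) (x ^ 2) ^ 2 * (qProd (x ^ 2) ((x ^ 2) ^ 2) ^ 4 +
      4 * x * qProd ((x ^ 2) ^ 2) ((x ^ 2) ^ 2) ^ 4) = qProd x (x ^ 2) ^ 4 := by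
  have hy := norm_sq_lt_one hx
  have hy0 := pow_ne_zero 2 hx0
  have h := tsum_thetaTerm_sq hx0 hx
  rw [tsum_thetaTerm hx0 hx one_ne_zero, tsum_thetaTerm hy0 hy one_ne_zero,
    tsum_thetaTerm hy0 hy hy0, mul_inv_cancel₀ hy0,
    qProd_eq_one_add_mul 1 (norm_sq_lt_one hy), ← qProd_neg_mul_qProd (x ^ 2) hy] at h
  simp only [inv_one, mul_one, one_mul, ← sq] at h
  have hQ : qProd (-x ^ 2) (x ^ 2) ≠ 0 := qProd_ne_zero (by simpa using hy) hy
  refine mul_left_cancel₀ (pow_ne_zero 2 hQ) ?_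
  linear_combination -h

end ThetaDuplication

lemma qpow_ne_zero (τ : ℂ) (r : ℝ) : qpow τ r ≠ 0 := Complex.exp_ne_zero _

lemma qpow_add (τ : ℂ) (r s : ℝ) : qpow τ (r + s) = qpow τ r * qpow τ s := by
  rw [qpow, qpow, qpow, ← Complex.exp_add]
  push_cast
  ring_nf

lemma qpow_nat_mul (τ : ℂ) (n : ℕ) (r : ℝ) : qpow τ (n * r) = qpow τ r ^ n := by
  rw [qpow, qpow, ← Complex.exp_nat_mul]
  push_cast
  ring_nf

lemma qpow_two_mul (τ : ℂ) (r : ℝ) : qpow (2 * τ) r = qpow τ r ^ 2 := by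
  rw [qpow, qpow, ← Complex.exp_nat_mul]
  push_cast
  ring_nf

lemma norm_qpow_lt_one {τ : ℂ} (hτ : 0 < τ.im) {r : ℝ} (hr : 0 < r) : ‖qpow τ r‖ < 1 := by
  rw [qpow, Complex.norm_exp, Real.exp_lt_one_iff]
  simp
  positivity

lemma pWeb_eq {τ : ℂ} (hτ : 0 < τ.im) {x : ℂ} (hx : qpow τ (1 / 4) = x) :
    pWeb τ = 2 * qpow τ (1 / 16) * (qProd (x ^ 2) (x ^ 2) / qProd x (x ^ 2)) ^ 2 := by
  have hx1 : ‖x‖ < 1 := hx ▸ norm_qpow_lt_one hτ (by norm_num)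
  have hy := norm_sq_lt_one hx1
  have hodd (n : ℕ) : qpow τ (((n : ℝ) + 1) / 2 - 1 / 4) = x * (x ^ 2) ^ n := by
    rw [show ((n : ℝ) + 1) / 2 - 1 / 4 = ((2 * n + 1 : ℕ) : ℝ) * (1 / 4) by push_cast; ring,
      qpow_nat_mul, hx]
    ring
  have heven (n : ℕ) : qpow τ (((n : ℝ) + 1) / 2) = x ^ 2 * (x ^ 2) ^ n := by
    rw [show ((n : ℝ) + 1) / 2 = ((2 * n + 2 : ℕ) : ℝ) * (1 / 4) by push_cast; ring,
      qpow_nat_mul, hx]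
    ring
  simp only [pWeb, hodd, heven]
  have h := (hasProd_qProd (x ^ 2) hy).div₀ (hasProd_qProd x hy) (qProd_ne_zero hx1 hy)
  rw [(h.pow 2).tprod_eq]

/-- If `τ` lies in the upper half-plane, then `𝔭(τ)²𝔭(2τ)² + 𝔭(τ)² - 2𝔭(2τ) = 0`. -/
theorem p_duplication (τ : ℂ) (hτ : 0 < τ.im) :
    pWeb τ ^ 2 * pWeb (2 * τ) ^ 2 + pWeb τ ^ 2 - 2 * pWeb (2 * τ) = 0 := by
  have hτ2 : 0 < (2 * τ).im := by simpa using hτ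
  set x := qpow τ (1 / 4) with hx
  have hx0 : x ≠ 0 := qpow_ne_zero _ _
  have hx1 : ‖x‖ < 1 := norm_qpow_lt_one hτ (by norm_num)
  have hy := norm_sq_lt_one hx1
  have hc : qpow τ (1 / 16) ^ 4 = x := by
    rw [← qpow_nat_mul, hx]; norm_num
  have hO := qProd_ne_zero hx1 hy
  have hO2 := qProd_ne_zero hy (norm_sq_lt_one hy)
  have hdup := qProd_duplication hx0 hx1
  have hE := qProd_eq_even_mul_odd (x ^ 2) hy
  rw [← sq] at hE
  rw [pWeb_eq hτ rfl, pWeb_eq hτ2 (qpow_two_mul τ _), qpow_two_mul, ← hx]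
  generalize qpow τ (1 / 16) = c at *
  generalize qProd (x ^ 2) (x ^ 2) = E at *
  generalize qProd x (x ^ 2) = O at *
  generalize qProd (x ^ 2) ((x ^ 2) ^ 2) = O₂ at *
  generalize qProd ((x ^ 2) ^ 2) ((x ^ 2) ^ 2) = E₂ at *
  have key : E ^ 4 * (O₂ ^ 4 + 4 * c ^ 4 * E₂ ^ 4) = E₂ ^ 2 * O₂ ^ 2 * O ^ 4 := by
    rw [hc, ← hdup, hE]; ring
  field_simp
  linear_combination 4 * c ^ 2 * key
end

section
/- Let τ lie in the complex upper half-plane and set x = 𝔟(τ), y = 𝔟(2τ). Then x²·y² + 4·y² − 16·x = 0. -/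
/-- `𝔟(τ) = 2 ∏_{n≥1} ((1 - q^{n/2 - 1/4})/(1 + q^{n/2 - 1/4}))²`. -/
noncomputable def bWeb (τ : ℂ) : ℂ :=
  2 * ∏' n : ℕ,
    ((1 - qpow τ (((n : ℝ) + 1) / 2 - 1/4)) / (1 + qpow τ (((n : ℝ) + 1) / 2 - 1/4))) ^ 2

/-- The Euler product `∏_{n ≥ 1} (1 - Q^n)`. -/
noncomputable def eulerProd (Q : ℂ) : ℂ := ∏' n : ℕ, (1 - Q ^ (n + 1))

/-- The product `∏_{n ≥ 0} (1 + p^(2n+1))` over odd exponents. -/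
noncomputable def oddProd (p : ℂ) : ℂ := ∏' n : ℕ, (1 + p ^ (2 * n + 1))

/-- The finite product `∏_{n = 1}^m (1 - Q^n)`. -/
noncomputable def qFact (Q : ℂ) (m : ℕ) : ℂ := ∏ n ∈ Finset.range m, (1 - Q ^ (n + 1))

/-- The inverse of `qFact Q m`, extended by zero to negative `m`. -/
noncomputable def qFactInv (Q : ℂ) (m : ℤ) : ℂ := if m < 0 then 0 else (qFact Q m.toNat)⁻¹

/-- The theta constant `∑_{k ∈ ℤ} p^(k²)`. -/
noncomputable def thetaConst (p : ℂ) : ℂ := ∑' k : ℤ, p ^ (k ^ 2)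

lemma one_sub_pow_succ_ne_zero {Q : ℂ} (hQ : ‖Q‖ < 1) (n : ℕ) : 1 - Q ^ (n + 1) ≠ 0 := by
  intro h
  have h1 : ‖Q ^ (n + 1)‖ < 1 := by
    rw [norm_pow]; exact pow_lt_one₀ (norm_nonneg _) hQ (by omega)
  rw [← sub_eq_zero.1 h] at h1
  simp at h1

lemma qFact_ne_zero {Q : ℂ} (hQ : ‖Q‖ < 1) (m : ℕ) : qFact Q m ≠ 0 :=
  Finset.prod_ne_zero_iff.2 fun n _ => one_sub_pow_succ_ne_zero hQ n

lemma summable_norm_pow_succ {Q : ℂ} (hQ : ‖Q‖ < 1) : Summable fun n : ℕ => ‖Q ^ (n + 1)‖ := by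
  simp only [norm_pow]
  exact (summable_nat_add_iff 1).2 (summable_geometric_of_lt_one (norm_nonneg _) hQ)

lemma summable_norm_pow_odd {p : ℂ} (hp : ‖p‖ < 1) :
    Summable fun n : ℕ => ‖p ^ (2 * n + 1)‖ :=
  (summable_norm_pow_succ hp).comp_injective (i := fun n => 2 * n)
    fun a b h => by simpa using h

lemma multipliable_eulerProd {Q : ℂ} (hQ : ‖Q‖ < 1) :
    Multipliable fun n : ℕ => 1 - Q ^ (n + 1) := by
  simp only [sub_eq_add_neg]
  exact multipliable_one_add_of_summable (by simpa using summable_norm_pow_succ hQ)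

lemma multipliable_oddProd {p : ℂ} (hp : ‖p‖ < 1) :
    Multipliable fun n : ℕ => 1 + p ^ (2 * n + 1) :=
  multipliable_one_add_of_summable (summable_norm_pow_odd hp)

lemma eulerProd_ne_zero {Q : ℂ} (hQ : ‖Q‖ < 1) : eulerProd Q ≠ 0 := by
  have h := tprod_one_add_ne_zero_of_summable (f := fun n : ℕ => -Q ^ (n + 1))
    (fun n => by simpa [← sub_eq_add_neg] using one_sub_pow_succ_ne_zero hQ n)
    (by simpa using summable_norm_pow_succ hQ)
  simpa [eulerProd, sub_eq_add_neg] using h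

lemma neg_pow_odd (p : ℂ) (n : ℕ) : (-p) ^ (2 * n + 1) = -p ^ (2 * n + 1) :=
  Odd.neg_pow ⟨n, rfl⟩ p

lemma oddProd_ne_zero {p : ℂ} (hp : ‖p‖ < 1) : oddProd p ≠ 0 := by
  refine tprod_one_add_ne_zero_of_summable (fun n => ?_) (summable_norm_pow_odd hp)
  have h := one_sub_pow_succ_ne_zero (Q := -p) (by simpa using hp) (2 * n)
  rwa [neg_pow_odd, sub_neg_eq_add] at h

lemma oddProd_mul_oddProd_neg {p : ℂ} (hp : ‖p‖ < 1) :
    oddProd p * oddProd (-p) = oddProd (-p ^ 2) := by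
  have hp' : ‖-p‖ < 1 := by simpa using hp
  rw [oddProd, oddProd, oddProd,
    ← (multipliable_oddProd hp).tprod_mul (multipliable_oddProd hp')]
  refine tprod_congr fun n => ?_
  rw [neg_pow_odd, neg_pow_odd]
  ring

lemma eulerProd_eq {Q : ℂ} (hQ : ‖Q‖ < 1) :
    eulerProd Q = eulerProd (Q ^ 2) * oddProd (-Q) := by
  have hQ2 : ‖Q ^ 2‖ < 1 := by
    rw [norm_pow]; exact pow_lt_one₀ (norm_nonneg _) hQ two_ne_zero
  have ho : (fun n : ℕ => 1 + (-Q) ^ (2 * n + 1)) = fun n : ℕ => 1 - Q ^ (2 * n + 1) := by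
    funext n; rw [neg_pow_odd, sub_eq_add_neg]
  have he : (fun n : ℕ => 1 - (Q ^ 2) ^ (n + 1)) = fun n : ℕ => 1 - Q ^ (2 * n + 1 + 1) := by
    funext n; rw [← pow_mul]; congr 2
  have h1 := multipliable_oddProd (p := -Q) (by simpa using hQ)
  have h2 := multipliable_eulerProd hQ2
  rw [ho] at h1
  rw [he] at h2
  rw [eulerProd, eulerProd, oddProd, ho, he, mul_comm]
  exact (tprod_even_mul_odd (f := fun m : ℕ => 1 - Q ^ (m + 1)) h1 h2).symm

lemma qFactInv_sub_one {Q : ℂ} (hQ : ‖Q‖ < 1) (m : ℤ) :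
    qFactInv Q (m - 1) = (1 - Q ^ m) * qFactInv Q m := by
  rcases lt_trichotomy m 0 with h | rfl | h
  · simp [qFactInv, h, show m < 1 by omega]
  · simp [qFactInv]
  · obtain ⟨n, rfl⟩ : ∃ n : ℕ, m = n + 1 := ⟨(m - 1).toNat, by omega⟩
    have h0 : ¬ ((n : ℤ) + 1 < 0) := by omega
    have h1 : ((n : ℤ) + 1).toNat = n + 1 := by omega
    have h2 : Q ^ ((n : ℤ) + 1) = Q ^ (n + 1) := by exact_mod_cast zpow_natCast Q (n + 1)
    have h3 := one_sub_pow_succ_ne_zero hQ n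
    have h4 := qFact_ne_zero hQ n
    simp only [qFactInv, h0, h1, h2, add_sub_cancel_right, if_false, Int.toNat_natCast,
      show ¬ ((n : ℤ) < 0) by omega]
    rw [show qFact Q (n + 1) = qFact Q n * (1 - Q ^ (n + 1)) from Finset.prod_range_succ _ _]
    field_simp

/-- The `k`-th term in the finite triple product identity. -/
noncomputable def tripleTerm (p : ℂ) (N : ℕ) (k : ℤ) : ℂ :=
  p ^ (k ^ 2) * (qFact (p ^ 2) (2 * N) * qFactInv (p ^ 2) (N - k) * qFactInv (p ^ 2) (N + k))

lemma tripleTerm_succ {p : ℂ} (hp : ‖p‖ < 1) (hp0 : p ≠ 0) (N : ℕ) (k : ℤ) :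
    tripleTerm p (N + 1) k = (1 + p ^ (4 * N + 2)) * tripleTerm p N k +
      p ^ (2 * N + 1) * (tripleTerm p N (k + -1) + tripleTerm p N (k + 1)) := by
  have hQ : ‖p ^ 2‖ < 1 := by
    rw [norm_pow]; exact pow_lt_one₀ (norm_nonneg _) hp two_ne_zero
  have hD : qFact (p ^ 2) (2 * (N + 1)) =
      qFact (p ^ 2) (2 * N) * (1 - (p ^ 2) ^ (2 * N + 1)) * (1 - (p ^ 2) ^ (2 * N + 2)) := by
    rw [show 2 * (N + 1) = 2 * N + 1 + 1 by ring, qFact, Finset.prod_range_succ,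
      Finset.prod_range_succ, qFact]
  have r1 := qFactInv_sub_one hQ (N + 1 - k)
  have r2 := qFactInv_sub_one hQ (N + 1 + k)
  have r3 := qFactInv_sub_one hQ (N - k)
  have r4 := qFactInv_sub_one hQ (N + k)
  rw [show (N : ℤ) + 1 - k - 1 = N - k by ring] at r1
  rw [show (N : ℤ) + 1 + k - 1 = N + k by ring] at r2
  rw [r1] at r3
  rw [r2] at r4
  simp only [tripleTerm, hD, Nat.cast_add, Nat.cast_one]
  rw [show (N : ℤ) - (k + -1) = N + 1 - k by ring, show (N : ℤ) + (k + -1) = N + k - 1 by ring,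
    show (N : ℤ) - (k + 1) = N - k - 1 by ring, show (N : ℤ) + (k + 1) = N + 1 + k by ring,
    r1, r2, r3, r4]
  generalize qFactInv (p ^ 2) (N + 1 - k) = u
  generalize qFactInv (p ^ 2) (N + 1 + k) = v
  generalize qFact (p ^ 2) (2 * N) = D
  have hK : p ^ k ≠ 0 := zpow_ne_zero _ hp0
  have e1 : p ^ ((k + -1) ^ 2) = p ^ (k ^ 2) * p / (p ^ k) ^ 2 := by
    rw [show (k + -1) ^ 2 = k ^ 2 + 1 - k * 2 by ring, zpow_sub₀ hp0, zpow_add₀ hp0, zpow_one,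
      zpow_mul]
    norm_cast
  have e2 : p ^ ((k + 1) ^ 2) = p ^ (k ^ 2) * p * (p ^ k) ^ 2 := by
    rw [show (k + 1) ^ 2 = k ^ 2 + 1 + k * 2 by ring, zpow_add₀ hp0, zpow_add₀ hp0, zpow_one,
      zpow_mul]
    norm_cast
  have hQ0 : p ^ 2 ≠ 0 := pow_ne_zero _ hp0
  have eK : (p ^ 2) ^ k = (p ^ k) ^ 2 := by
    rw [← zpow_natCast, ← zpow_natCast, ← zpow_mul, ← zpow_mul, mul_comm]
  have e3 : (p ^ 2) ^ ((N : ℤ) + 1 - k) = (p ^ N) ^ 2 * p ^ 2 / (p ^ k) ^ 2 := by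
    rw [zpow_sub₀ hQ0, zpow_add₀ hQ0, zpow_one, eK, zpow_natCast]; ring
  have e4 : (p ^ 2) ^ ((N : ℤ) + 1 + k) = (p ^ N) ^ 2 * p ^ 2 * (p ^ k) ^ 2 := by
    rw [zpow_add₀ hQ0, zpow_add₀ hQ0, zpow_one, eK, zpow_natCast]; ring
  have e5 : (p ^ 2) ^ ((N : ℤ) - k) = (p ^ N) ^ 2 / (p ^ k) ^ 2 := by
    rw [zpow_sub₀ hQ0, eK, zpow_natCast]; ring
  have e6 : (p ^ 2) ^ ((N : ℤ) + k) = (p ^ N) ^ 2 * (p ^ k) ^ 2 := by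
    rw [zpow_add₀ hQ0, eK, zpow_natCast]; ring
  have e7 : p ^ (4 * N + 2) = (p ^ N) ^ 4 * p ^ 2 := by ring
  have e8 : p ^ (2 * N + 1) = (p ^ N) ^ 2 * p := by ring
  have e9 : (p ^ 2) ^ (2 * N + 1) = (p ^ N) ^ 4 * p ^ 2 := by ring
  have e10 : (p ^ 2) ^ (2 * N + 2) = (p ^ N) ^ 4 * p ^ 4 := by ring
  rw [e1, e2, e3, e4, e5, e6, e7, e8, e9, e10]
  generalize p ^ k = K at *
  generalize p ^ N = X
  generalize p ^ (k ^ 2) = S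
  field_simp
  ring

lemma hasSum_tripleTerm {p : ℂ} (hp : ‖p‖ < 1) (hp0 : p ≠ 0) (N : ℕ) :
    HasSum (tripleTerm p N) (∏ n ∈ Finset.range N, (1 + p ^ (2 * n + 1)) ^ 2) := by
  induction N with
  | zero =>
    have h : tripleTerm p 0 0 = 1 := by simp [tripleTerm, qFactInv, qFact]
    rw [Finset.prod_range_zero, ← h]
    refine hasSum_single 0 fun k hk => ?_
    rcases lt_or_gt_of_ne hk with h | h <;> simp [tripleTerm, qFactInv, h]
  | succ N ih =>
    have h1 := (Equiv.addRight (-1 : ℤ)).hasSum_iff.2 ih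
    have h2 := (Equiv.addRight (1 : ℤ)).hasSum_iff.2 ih
    have h := (ih.mul_left (1 + p ^ (4 * N + 2))).add ((h1.add h2).mul_left (p ^ (2 * N + 1)))
    rw [Finset.prod_range_succ]
    simp only [Function.comp_apply, Equiv.coe_addRight, ← tripleTerm_succ hp hp0] at h
    convert! h using 1
    ring

lemma tendsto_qFact {Q : ℂ} (hQ : ‖Q‖ < 1) :
    Filter.Tendsto (qFact Q) Filter.atTop (nhds (eulerProd Q)) :=
  (multipliable_eulerProd hQ).tendsto_prod_tprod_nat

lemma tendsto_qFactInv {Q : ℂ} (hQ : ‖Q‖ < 1) :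
    Filter.Tendsto (qFactInv Q) Filter.atTop (nhds (eulerProd Q)⁻¹) := by
  have h : Filter.Tendsto Int.toNat Filter.atTop Filter.atTop :=
    Filter.tendsto_atTop.2 fun b => by
      filter_upwards [Filter.eventually_ge_atTop (b : ℤ)] with a ha
      omega
  refine (((tendsto_qFact hQ).inv₀ (eulerProd_ne_zero hQ)).comp h).congr' ?_
  filter_upwards [Filter.eventually_ge_atTop (0 : ℤ)] with a ha
  simp [qFactInv, not_lt.2 ha]

lemma exists_norm_qFact_le {Q : ℂ} (hQ : ‖Q‖ < 1) : ∃ C, ∀ n, ‖qFact Q n‖ ≤ C := by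
  obtain ⟨C, hC⟩ := (tendsto_qFact hQ).norm.bddAbove_range
  exact ⟨C, fun n => hC ⟨n, rfl⟩⟩

lemma exists_norm_qFactInv_le {Q : ℂ} (hQ : ‖Q‖ < 1) : ∃ C, ∀ n, ‖qFactInv Q n‖ ≤ C := by
  obtain ⟨C, hC⟩ := ((tendsto_qFact hQ).inv₀ (eulerProd_ne_zero hQ)).norm.bddAbove_range
  have hC' : ∀ n, ‖(qFact Q n)⁻¹‖ ≤ C := fun n => hC ⟨n, rfl⟩
  refine ⟨C, fun n => ?_⟩
  unfold qFactInv
  split_ifs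
  · simpa using (norm_nonneg _).trans (hC' 0)
  · exact hC' _

lemma summable_norm_zpow_sq {p : ℂ} (hp : ‖p‖ < 1) : Summable fun k : ℤ => ‖p ^ (k ^ 2)‖ := by
  have h : Summable fun n : ℕ => ‖p ^ ((n : ℤ) ^ 2)‖ := by
    refine (summable_geometric_of_lt_one (norm_nonneg p) hp).of_nonneg_of_le
      (fun _ => norm_nonneg _) fun n => ?_
    rw [← Nat.cast_pow, zpow_natCast, norm_pow]
    exact pow_le_pow_of_le_one (norm_nonneg _) hp.le (Nat.le_self_pow two_ne_zero n)
  exact .of_nat_of_neg h (by simpa using h)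

/-- The Jacobi triple product identity for theta constants. -/
lemma thetaConst_eq {p : ℂ} (hp : ‖p‖ < 1) (hp0 : p ≠ 0) :
    thetaConst p = eulerProd (p ^ 2) * oddProd p ^ 2 := by
  have hQ : ‖p ^ 2‖ < 1 := by
    rw [norm_pow]; exact pow_lt_one₀ (norm_nonneg _) hp two_ne_zero
  obtain ⟨C, hC⟩ := exists_norm_qFact_le hQ
  obtain ⟨C', hC'⟩ := exists_norm_qFactInv_le hQ
  have hC0 : 0 ≤ C := (norm_nonneg _).trans (hC 0)
  have hC0' : 0 ≤ C' := (norm_nonneg _).trans (hC' 0)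
  have hE := eulerProd_ne_zero hQ
  have h1 : Filter.Tendsto (fun N => ∑' k, tripleTerm p N k) Filter.atTop
      (nhds (∑' k : ℤ, p ^ (k ^ 2) * (eulerProd (p ^ 2))⁻¹)) := by
    refine tendsto_tsum_of_dominated_convergence
      (bound := fun k : ℤ => ‖p ^ (k ^ 2)‖ * (C * C' * C'))
      ((summable_norm_zpow_sq hp).mul_right _) (fun k => ?_) (.of_forall fun N k => ?_)
    · have t1 := (tendsto_qFact hQ).comp
        (Filter.tendsto_id.const_mul_atTop' (r := 2) two_pos)
      have t2 := (tendsto_qFactInv hQ).comp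
        (Filter.tendsto_atTop_add_const_right _ (-k) tendsto_natCast_atTop_atTop)
      have t3 := (tendsto_qFactInv hQ).comp
        (Filter.tendsto_atTop_add_const_right _ k tendsto_natCast_atTop_atTop)
      convert! ((t1.mul t2).mul t3).const_mul (p ^ (k ^ 2)) using 2
      field_simp
    · rw [tripleTerm, norm_mul, norm_mul, norm_mul]
      gcongr
      · exact hC _
      · exact hC' _
      · exact hC' _
  have h2 : Filter.Tendsto (fun N => ∑' k, tripleTerm p N k) Filter.atTop
      (nhds (oddProd p ^ 2)) := by
    have h := (multipliable_oddProd hp).tendsto_prod_tprod_nat.pow 2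
    refine h.congr fun N => ?_
    rw [(hasSum_tripleTerm hp hp0 N).tsum_eq, Finset.prod_pow]
  have h := tendsto_nhds_unique h1 h2
  rw [tsum_mul_right] at h
  rw [← h, thetaConst]
  field_simp

lemma thetaConst_sq_add_sq {p : ℂ} (hp : ‖p‖ < 1) (hp0 : p ≠ 0) :
    thetaConst p ^ 2 + thetaConst (-p) ^ 2 = 2 * thetaConst (p ^ 2) ^ 2 := by
  have hp' : ‖-p‖ < 1 := by simpa using hp
  have hQ : ‖p ^ 2‖ < 1 := by
    rw [norm_pow]; exact pow_lt_one₀ (norm_nonneg _) hp two_ne_zero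
  have s1 := summable_norm_zpow_sq hp
  have s2 := summable_norm_zpow_sq hp'
  have s3 := summable_norm_zpow_sq hQ
  simp only [thetaConst, sq (∑' _ : ℤ, _)]
  rw [tsum_mul_tsum_of_summable_norm s1 s1, tsum_mul_tsum_of_summable_norm s2 s2,
    tsum_mul_tsum_of_summable_norm s3 s3, ← tsum_mul_left,
    ← (summable_mul_of_summable_norm s1 s1).tsum_add (summable_mul_of_summable_norm s2 s2)]
  have key : ∀ z : ℤ × ℤ, p ^ (z.1 ^ 2) * p ^ (z.2 ^ 2) + (-p) ^ (z.1 ^ 2) * (-p) ^ (z.2 ^ 2) =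
      if Even (z.1 + z.2) then 2 * p ^ (z.1 ^ 2 + z.2 ^ 2) else 0 := by
    intro z
    rw [← zpow_add₀ hp0, ← zpow_add₀ (neg_ne_zero.2 hp0)]
    have hpar : Even (z.1 ^ 2 + z.2 ^ 2) ↔ Even (z.1 + z.2) := by
      simp [Int.even_add, Int.even_pow]
    split_ifs with h
    · rw [(hpar.2 h).neg_zpow]; ring
    · rw [(Int.not_even_iff_odd.1 (mt hpar.1 h)).neg_zpow]; ring
  simp only [key]
  have hinj : Function.Injective fun z : ℤ × ℤ => (z.1 + z.2, z.1 - z.2) := by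
    rintro ⟨a, b⟩ ⟨c, d⟩ h
    simp only [Prod.mk.injEq] at h ⊢
    omega
  rw [← hinj.tsum_eq]
  · refine tsum_congr fun z => ?_
    have hz : Even (z.1 + z.2 + (z.1 - z.2)) := ⟨z.1, by ring⟩
    rw [if_pos hz, ← zpow_add₀ (pow_ne_zero 2 hp0), ← zpow_natCast p 2, ← zpow_mul]
    congr 2
    push_cast
    ring
  · rintro ⟨a, b⟩ h
    have he : Even (a + b) := by
      by_contra h'
      simp [h'] at h
    obtain ⟨c, hc⟩ := he
    exact ⟨(c, a - c), by simp only [Prod.mk.injEq]; omega⟩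

lemma oddProd_sq_relation {p : ℂ} (hp : ‖p‖ < 1) (hp0 : p ≠ 0) :
    oddProd (-p ^ 2) ^ 2 * (oddProd p ^ 4 + oddProd (-p) ^ 4) = 2 * oddProd (p ^ 2) ^ 4 := by
  have hQ : ‖p ^ 2‖ < 1 := by
    rw [norm_pow]; exact pow_lt_one₀ (norm_nonneg _) hp two_ne_zero
  have hR : ‖(p ^ 2) ^ 2‖ < 1 := by
    rw [norm_pow]; exact pow_lt_one₀ (norm_nonneg _) hQ two_ne_zero
  have h := thetaConst_sq_add_sq hp hp0
  rw [thetaConst_eq hp hp0, thetaConst_eq (p := -p) (by simpa using hp) (neg_ne_zero.2 hp0),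
    thetaConst_eq hQ (pow_ne_zero 2 hp0), neg_sq, eulerProd_eq hQ] at h
  have hE := eulerProd_ne_zero hR
  refine mul_left_cancel₀ (pow_ne_zero 2 hE) ?_
  linear_combination h

lemma bWeb_eq {τ p : ℂ} (hp : ‖p‖ < 1) (hpτ : p = Complex.exp (Real.pi * Complex.I * τ / 2)) :
    bWeb τ = 2 * (oddProd (-p) / oddProd p) ^ 2 := by
  have hp' : ‖-p‖ < 1 := by simpa using hp
  have hq : ∀ n : ℕ, qpow τ (((n : ℝ) + 1) / 2 - 1 / 4) = p ^ (2 * n + 1) := fun n => by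
    rw [qpow, hpτ, ← Complex.exp_nat_mul]
    congr 1
    push_cast
    ring
  have h1 := multipliable_oddProd hp
  have h2 := multipliable_oddProd hp'
  have h0 := oddProd_ne_zero hp
  have hm := h2.tprod_div₀ h1 h0
  have hd := h2.hasProd.div₀ h1.hasProd h0
  simp only [bWeb, hq]
  rw [oddProd, oddProd, ← hm, ← hd.multipliable.tprod_pow]
  simp only [neg_pow_odd, sub_eq_add_neg]

/-- If `τ` lies in the upper half-plane, `x = 𝔟(τ)` and `y = 𝔟(2τ)`,
then `x²y² + 4y² - 16x = 0`. -/
theorem b_duplication (τ : ℂ) (hτ : 0 < τ.im) :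
    bWeb τ ^ 2 * bWeb (2 * τ) ^ 2 + 4 * bWeb (2 * τ) ^ 2 - 16 * bWeb τ = 0 := by
  obtain ⟨p, hpτ⟩ : ∃ p, p = Complex.exp (Real.pi * Complex.I * τ / 2) := ⟨_, rfl⟩
  have hp0 : p ≠ 0 := hpτ ▸ Complex.exp_ne_zero _
  have hp : ‖p‖ < 1 := by
    rw [hpτ, Complex.norm_exp, Real.exp_lt_one_iff]
    have := mul_pos Real.pi_pos hτ
    simp
    linarith
  have hQ : ‖p ^ 2‖ < 1 := by
    rw [norm_pow]; exact pow_lt_one₀ (norm_nonneg _) hp two_ne_zero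
  have hQτ : p ^ 2 = Complex.exp (Real.pi * Complex.I * (2 * τ) / 2) := by
    rw [hpτ, ← Complex.exp_nat_mul]
    congr 1
    push_cast
    ring
  rw [bWeb_eq hp hpτ, bWeb_eq hQ hQτ]
  have ha := oddProd_ne_zero hp
  have hc := oddProd_ne_zero hQ
  have hd := oddProd_mul_oddProd_neg hp
  have h := oddProd_sq_relation hp hp0
  rw [← hd] at h ⊢
  generalize oddProd p = a at *
  generalize oddProd (-p) = b at *
  generalize oddProd (p ^ 2) = c at *
  field_simp
  linear_combination 16 * b ^ 2 * h
end

section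
/- Let τ lie in the complex upper half-plane. Then (1 − 6·v(τ)² + v(τ)⁴)·η(2τ)²·η(8τ)⁴ = v(τ)²·η(τ)⁴·η(4τ)²; equivalently, v(τ)^{−2} + v(τ)² − 6 = η(τ)⁴η(4τ)²/(η(2τ)²η(8τ)⁴). -/
/-- The Kronecker symbol `(2/n)`: `+1` if `n ≡ ±1 (mod 8)`, `-1` if `n ≡ ±3 (mod 8)`,
`0` if `n` is even. -/
def chi8 (n : ℕ) : ℤ :=
  if n % 8 = 1 ∨ n % 8 = 7 then 1 else if n % 8 = 3 ∨ n % 8 = 5 then -1 else 0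

/-- Ramanujan's continued fraction value
`v(τ) = q^{1/2} ∏_{n≥1} (1 - q^n)^{χ₈(n)}`, `q = exp(2πiτ)`. -/
noncomputable def vRam (τ : ℂ) : ℂ :=
  qpow τ (1/2) * ∏' n : ℕ, (1 - qpow τ ((n : ℝ) + 1)) ^ chi8 (n + 1)

/-- The Dedekind eta function `η(τ) = q^{1/24} ∏_{n≥1} (1 - q^n)`, `q = exp(2πiτ)`. -/
noncomputable def dedekindEta (τ : ℂ) : ℂ :=
  qpow τ (1/24) * ∏' n : ℕ, (1 - qpow τ ((n : ℝ) + 1))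

open Filter Topology

/-- The infinite `q`-Pochhammer symbol `(a; p)_∞ = ∏_{n ≥ 0} (1 - a pⁿ)`. -/
noncomputable def qPoch (a p : ℂ) : ℂ := ∏' n : ℕ, (1 - a * p ^ n)

/-- The theta series `∑_{n ∈ ℤ} q^{n²} zⁿ`. -/
noncomputable def thetaSeries (q z : ℂ) : ℂ := ∑' n : ℤ, q ^ (n * n) * z ^ n

/-- The Gaussian binomial coefficient with base `p`. -/
def gaussBinom (p : ℂ) : ℕ → ℕ → ℂ
  | _, 0 => 1
  | 0, _ + 1 => 0
  | n + 1, k + 1 => gaussBinom p n k + p ^ (k + 1) * gaussBinom p n (k + 1)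

lemma norm_pow_lt_one {q : ℂ} (hq : ‖q‖ < 1) {n : ℕ} (hn : n ≠ 0) : ‖q ^ n‖ < 1 := by
  rw [norm_pow]; exact pow_lt_one₀ (norm_nonneg _) hq hn

section qPoch

variable {a p : ℂ}

lemma summable_norm_neg_mul_pow (a : ℂ) (hp : ‖p‖ < 1) :
    Summable fun n : ℕ ↦ ‖-(a * p ^ n)‖ := by
  simpa using (summable_geometric_of_lt_one (norm_nonneg p) hp).mul_left ‖a‖

lemma hasProd_qPoch (a : ℂ) (hp : ‖p‖ < 1) :
    HasProd (fun n : ℕ ↦ 1 - a * p ^ n) (qPoch a p) := by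
  simpa [sub_eq_add_neg, qPoch] using
    (multipliable_one_add_of_summable (summable_norm_neg_mul_pow a hp)).hasProd

lemma qPoch_ne_zero (ha : ‖a‖ < 1) (hp : ‖p‖ < 1) : qPoch a p ≠ 0 := by
  have := tprod_one_add_ne_zero_of_summable (f := fun n : ℕ ↦ -(a * p ^ n)) (fun n h ↦ ?_)
    (summable_norm_neg_mul_pow a hp)
  · simpa [sub_eq_add_neg, qPoch] using this
  · have h1 : a * p ^ n = 1 := by linear_combination -h
    have h2 : ‖a * p ^ n‖ < 1 := by
      rw [norm_mul, norm_pow]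
      exact mul_lt_one_of_nonneg_of_lt_one_left (norm_nonneg _) ha
        (pow_le_one₀ (norm_nonneg _) hp.le)
    simp [h1] at h2

lemma qPoch_even_mul_odd (a : ℂ) (hp : ‖p‖ < 1) :
    qPoch a (p ^ 2) * qPoch (a * p) (p ^ 2) = qPoch a p := by
  have hp2 : ‖p ^ 2‖ < 1 := norm_pow_lt_one hp two_ne_zero
  refine (HasProd.even_mul_odd (f := fun n : ℕ ↦ 1 - a * p ^ n) ?_ ?_).unique
    (hasProd_qPoch a hp)
  · simpa [pow_mul] using hasProd_qPoch a hp2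
  · convert hasProd_qPoch (a * p) hp2 using 2 with n
    ring

lemma qPoch_eq_mul (a : ℂ) (hp : ‖p‖ < 1) : qPoch a p = (1 - a) * qPoch (a * p) p := by
  have hshift : (fun n : ℕ ↦ 1 - a * p ^ (n + 1)) = fun n ↦ 1 - a * p * p ^ n := by
    ext n; ring
  have hm := (hasProd_qPoch (a * p) hp).multipliable
  rw [← hshift] at hm
  rw [qPoch, tprod_eq_zero_mul' (f := fun n : ℕ ↦ 1 - a * p ^ n) hm, qPoch, hshift]
  simp

lemma qPoch_mul_qPoch_neg (a : ℂ) (hp : ‖p‖ < 1) :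
    qPoch a p * qPoch (-a) p = qPoch (a ^ 2) (p ^ 2) := by
  have hp2 : ‖p ^ 2‖ < 1 := norm_pow_lt_one hp two_ne_zero
  refine ((hasProd_qPoch a hp).mul (hasProd_qPoch (-a) hp)).unique ?_
  convert hasProd_qPoch (a ^ 2) hp2 using 2 with n
  ring

end qPoch

section gaussBinom

variable {p q z : ℂ}

lemma gaussBinom_zero_right (p : ℂ) (n : ℕ) : gaussBinom p n 0 = 1 := by
  cases n <;> rfl

lemma gaussBinom_eq_zero_of_lt (p : ℂ) {n k : ℕ} (h : n < k) : gaussBinom p n k = 0 := by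
  induction n generalizing k with
  | zero => obtain ⟨k, rfl⟩ := Nat.exists_eq_succ_of_ne_zero h.ne'; rfl
  | succ n ih =>
    obtain ⟨k, rfl⟩ := Nat.exists_eq_succ_of_ne_zero (Nat.ne_zero_of_lt h)
    rw [Nat.succ_eq_add_one, gaussBinom, ih (by omega), ih (by omega)]
    simp

/-- The finite `q`-Pochhammer symbol `(p; p)_n`. -/
noncomputable def qPochFin (p : ℂ) (n : ℕ) : ℂ := ∏ i ∈ Finset.range n, (1 - p * p ^ i)

lemma qPochFin_succ (p : ℂ) (n : ℕ) :
    qPochFin p (n + 1) = qPochFin p n * (1 - p ^ (n + 1)) := by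
  rw [qPochFin, Finset.prod_range_succ, qPochFin, pow_succ']

lemma gaussBinom_mul_qPochFin (p : ℂ) (n k m : ℕ) (h : n = k + m) :
    gaussBinom p n k * (qPochFin p k * qPochFin p m) = qPochFin p n := by
  induction n generalizing k m with
  | zero =>
    obtain rfl : k = 0 := by omega
    obtain rfl : m = 0 := by omega
    simp [gaussBinom, qPochFin]
  | succ n ih =>
    rcases k with _ | k
    · obtain rfl : m = n + 1 := by omega
      simp [gaussBinom_zero_right, qPochFin]
    · rw [gaussBinom]
      rcases m with _ | m
      · have h1 := ih k 0 (by omega)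
        rw [gaussBinom_eq_zero_of_lt p (show n < k + 1 by omega)]
        obtain rfl : n = k := by omega
        rw [qPochFin_succ]
        linear_combination (1 - p ^ (n + 1)) * h1
      · have h1 := ih k (m + 1) (by omega)
        have h2 := ih (k + 1) m (by omega)
        obtain rfl : n = k + m + 1 := by omega
        rw [qPochFin_succ _ m] at h1 ⊢
        rw [qPochFin_succ _ k] at h2 ⊢
        rw [qPochFin_succ _ (k + m + 1)]
        linear_combination (1 - p ^ (k + 1)) * h1 + p ^ (k + 1) * (1 - p ^ (m + 1)) * h2

lemma qPochFin_ne_zero (hp : ‖p‖ < 1) (n : ℕ) : qPochFin p n ≠ 0 := by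
  refine Finset.prod_ne_zero_iff.mpr fun i _ h ↦ ?_
  have h1 : p ^ (i + 1) = 1 := by linear_combination -h
  have h2 := norm_pow_lt_one hp (Nat.succ_ne_zero i)
  simp [h1] at h2

lemma gaussBinom_eq_div (hp : ‖p‖ < 1) (k m : ℕ) :
    gaussBinom p (k + m) k = qPochFin p (k + m) / (qPochFin p k * qPochFin p m) := by
  rw [eq_div_iff (mul_ne_zero (qPochFin_ne_zero hp k) (qPochFin_ne_zero hp m))]
  exact gaussBinom_mul_qPochFin p _ k m rfl

lemma tendsto_qPochFin (hp : ‖p‖ < 1) :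
    Tendsto (qPochFin p) atTop (𝓝 (qPoch p p)) :=
  (hasProd_qPoch p hp).tendsto_prod_nat

lemma exists_norm_gaussBinom_le (hp : ‖p‖ < 1) : ∃ C, ∀ n k, ‖gaussBinom p n k‖ ≤ C := by
  obtain ⟨A, hA⟩ := (tendsto_qPochFin hp).norm.bddAbove_range
  obtain ⟨B, hB⟩ := ((tendsto_qPochFin hp).inv₀ (qPoch_ne_zero hp hp)).norm.bddAbove_range
  have hA' (n : ℕ) : ‖qPochFin p n‖ ≤ A := hA ⟨n, rfl⟩
  have hB' (n : ℕ) : ‖(qPochFin p n)⁻¹‖ ≤ B := hB ⟨n, rfl⟩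
  have hA0 : 0 ≤ A := (norm_nonneg _).trans (hA' 0)
  have hB0 : 0 ≤ B := (norm_nonneg _).trans (hB' 0)
  refine ⟨A * (B * B), fun n k ↦ ?_⟩
  rcases lt_or_ge n k with h | h
  · rw [gaussBinom_eq_zero_of_lt p h, norm_zero]; positivity
  · obtain ⟨m, rfl⟩ := Nat.exists_eq_add_of_le h
    rw [gaussBinom_eq_div hp, div_eq_mul_inv, mul_inv, norm_mul, norm_mul]
    gcongr
    exacts [hA' _, hB' _, hB' _]

/-- The `q`-binomial theorem. -/
lemma prod_one_add_mul_pow_odd (q x : ℂ) (n : ℕ) :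
    ∏ k ∈ Finset.range n, (1 + x * q ^ (2 * k + 1)) =
      ∑ k ∈ Finset.range (n + 1), gaussBinom (q ^ 2) n k * q ^ (k * k) * x ^ k := by
  induction n generalizing x with
  | zero => simp [gaussBinom]
  | succ n ih =>
    have h1 : ∏ k ∈ Finset.range n, (1 + x * q ^ (2 * (k + 1) + 1)) =
        ∑ k ∈ Finset.range (n + 1), gaussBinom (q ^ 2) n k * q ^ (k * k) * (x * q ^ 2) ^ k := by
      rw [← ih]
      exact Finset.prod_congr rfl fun k _ ↦ by ring
    have h2 : ∑ k ∈ Finset.range (n + 1), gaussBinom (q ^ 2) n k * q ^ (k * k) * (x * q ^ 2) ^ k =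
        1 + ∑ k ∈ Finset.range (n + 1), gaussBinom (q ^ 2) n (k + 1) * q ^ ((k + 1) * (k + 1)) *
          (x * q ^ 2) ^ (k + 1) := by
      rw [Finset.sum_range_succ', Finset.sum_range_succ _ n,
        gaussBinom_eq_zero_of_lt _ (Nat.lt_succ_self n)]
      simp [gaussBinom_zero_right, add_comm]
    rw [Finset.prod_range_succ', h1, mul_add, mul_one, Finset.sum_range_succ' _ (n + 1)]
    nth_rewrite 1 [h2]
    simp only [gaussBinom]
    rw [Finset.sum_mul, add_assoc, ← Finset.sum_add_distrib, add_comm]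
    simp only [mul_zero, pow_zero, mul_one]
    congr 1
    exact Finset.sum_congr rfl fun k _ ↦ by ring

end gaussBinom

section thetaSeries

variable {q z : ℂ}

lemma summable_thetaSeries (hq : ‖q‖ < 1) (hq0 : q ≠ 0) (hz : z ≠ 0) :
    Summable fun n : ℤ ↦ q ^ (n * n) * z ^ n := by
  have hlog : Real.log ‖q‖ < 0 := Real.log_neg (norm_pos_iff.mpr hq0) hq
  have hpi : (Real.pi : ℂ) ≠ 0 := mod_cast Real.pi_ne_zero
  have him : 0 < (Complex.log q / (Real.pi * Complex.I)).im := by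
    have : Complex.log q / (Real.pi * Complex.I) =
        -(Complex.I * Complex.log q) / (Real.pi : ℝ) := by
      field_simp
      simp
    rw [this, Complex.div_ofReal_im]
    apply div_pos _ Real.pi_pos
    simpa [Complex.log_re] using hlog
  refine ((summable_jacobiTheta₂_term_iff (Complex.log z / (2 * Real.pi * Complex.I)) _).mpr
    him).congr fun n ↦ ?_
  rw [jacobiTheta₂_term, Complex.exp_add]
  nth_rewrite 2 [← Complex.exp_log hz]
  nth_rewrite 2 [← Complex.exp_log hq0]
  rw [← Complex.exp_int_mul, ← Complex.exp_int_mul, mul_comm]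
  congr 2
  · field_simp
    push_cast
    ring
  · field_simp

lemma prod_jacobi_finite (hq0 : q ≠ 0) (hz : z ≠ 0) (n : ℕ) :
    ∏ k ∈ Finset.range (n + n), (1 + z / q ^ (2 * n) * q ^ (2 * k + 1)) =
      z ^ n / q ^ (n * n) * ((∏ k ∈ Finset.range n, (1 - -(z * q) * (q ^ 2) ^ k)) *
        ∏ k ∈ Finset.range n, (1 - -(q / z) * (q ^ 2) ^ k)) := by
  have h1 : ∏ k ∈ Finset.range n, (1 + z / q ^ (2 * n) * q ^ (2 * k + 1)) =
      z ^ n / q ^ (n * n) * ∏ k ∈ Finset.range n, (1 - -(q / z) * (q ^ 2) ^ k) := by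
    have h3 : z ^ n / q ^ (n * n) = ∏ k ∈ Finset.range n, z / q ^ (2 * k + 1) := by
      induction n with
      | zero => simp
      | succ n ih =>
        rw [Finset.prod_range_succ, ← ih]
        field_simp
        ring
    rw [← Finset.prod_range_reflect, h3, ← Finset.prod_mul_distrib]
    refine Finset.prod_congr rfl fun k hk ↦ ?_
    obtain ⟨m, rfl⟩ := Nat.exists_eq_add_of_lt (Finset.mem_range.mp hk)
    rw [show k + m + 1 - 1 - k = m by omega]
    field_simp
    ring
  have h2 (k : ℕ) : 1 + z / q ^ (2 * n) * q ^ (2 * (n + k) + 1) =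
      1 - -(z * q) * (q ^ 2) ^ k := by
    field_simp
    ring
  rw [Finset.prod_range_add, h1, Finset.prod_congr rfl fun k _ ↦ h2 k]
  ring

lemma tsum_jacobi_finite (hq0 : q ≠ 0) (hz : z ≠ 0) (n : ℕ) :
    (∏ k ∈ Finset.range n, (1 - -(z * q) * (q ^ 2) ^ k)) *
        ∏ k ∈ Finset.range n, (1 - -(q / z) * (q ^ 2) ^ k) =
      ∑' j : ℤ, (if -n ≤ j then gaussBinom (q ^ 2) (n + n) (j + n).toNat else 0) *
        (q ^ (j * j) * z ^ j) := by
  have hinj : Function.Injective fun k : ℕ ↦ (k : ℤ) - n := fun a b h ↦ by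
    simpa using h
  rw [← hinj.tsum_eq, tsum_eq_sum (s := Finset.range (n + n + 1))]
  · have h := prod_jacobi_finite hq0 hz n
    rw [prod_one_add_mul_pow_odd] at h
    have hne : z ^ n / q ^ (n * n) ≠ 0 := by positivity
    rw [← mul_right_inj' hne, ← h, Finset.mul_sum]
    refine Finset.sum_congr rfl fun k _ ↦ ?_
    have h1 : q ^ (((k : ℤ) - n) * (k - n)) = q ^ (k * k) * q ^ (n * n) / q ^ (2 * n * k) := by
      rw [show ((k : ℤ) - n) * (k - n) = ((k * k : ℕ) : ℤ) + (n * n : ℕ) - (2 * n * k : ℕ) by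
        push_cast; ring, zpow_sub₀ hq0, zpow_add₀ hq0]
      simp only [zpow_natCast]
    have h2 : z ^ ((k : ℤ) - n) = z ^ k / z ^ n := by
      rw [zpow_sub₀ hz]
      simp only [zpow_natCast]
    rw [if_pos (by omega), h1, h2, div_pow, ← pow_mul]
    simp only [sub_add_cancel, Int.toNat_natCast]
    field_simp
  · intro k hk
    rw [gaussBinom_eq_zero_of_lt _ (by simp at hk ⊢; omega)]
    simp
  · intro j hj
    have hj' : -(n : ℤ) ≤ j := by
      by_contra h
      simp [h] at hj
    exact ⟨(j + n).toNat, by simp only; omega⟩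

/-- The **Jacobi triple product identity**. -/
theorem thetaSeries_eq_qPoch (hq : ‖q‖ < 1) (hq0 : q ≠ 0) (hz : z ≠ 0) :
    thetaSeries q z =
      qPoch (q ^ 2) (q ^ 2) * (qPoch (-(z * q)) (q ^ 2) * qPoch (-(q / z)) (q ^ 2)) := by
  have hp : ‖q ^ 2‖ < 1 := norm_pow_lt_one hq two_ne_zero
  have hE := qPoch_ne_zero hp hp
  have hprod := ((hasProd_qPoch (-(z * q)) hp).tendsto_prod_nat).mul
    (hasProd_qPoch (-(q / z)) hp).tendsto_prod_nat
  simp_rw [tsum_jacobi_finite hq0 hz] at hprod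
  obtain ⟨C, hC⟩ := exists_norm_gaussBinom_le hp
  have hC0 : 0 ≤ C := (norm_nonneg _).trans (hC 0 0)
  have hsum := tendsto_tsum_of_dominated_convergence (𝓕 := atTop)
    (f := fun (n : ℕ) (j : ℤ) ↦ (if -n ≤ j then gaussBinom (q ^ 2) (n + n) (j + n).toNat else 0) *
        (q ^ (j * j) * z ^ j))
    (g := fun j ↦ (qPoch (q ^ 2) (q ^ 2))⁻¹ * (q ^ (j * j) * z ^ j))
    ((summable_thetaSeries hq hq0 hz).norm.mul_left C) (fun j ↦ ?_)
    (Eventually.of_forall fun n j ↦ ?_)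
  · have h := tendsto_nhds_unique hsum hprod
    rw [tsum_mul_left] at h
    rw [← h, thetaSeries, mul_inv_cancel_left₀ hE]
  · refine Tendsto.mul_const _ ?_
    have hE' : (qPoch (q ^ 2) (q ^ 2))⁻¹ = qPoch (q ^ 2) (q ^ 2) /
        (qPoch (q ^ 2) (q ^ 2) * qPoch (q ^ 2) (q ^ 2)) := by field_simp
    have ha : Tendsto (fun n : ℕ ↦ n + n) atTop atTop :=
      tendsto_atTop_mono (fun n ↦ Nat.le_add_left n n) tendsto_id
    have hb : Tendsto (fun n : ℕ ↦ (j + n).toNat) atTop atTop :=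
      tendsto_atTop.mpr fun b ↦ by
        filter_upwards [eventually_ge_atTop (b + j.natAbs)] with n hn
        omega
    have hc : Tendsto (fun n : ℕ ↦ (-j + n).toNat) atTop atTop :=
      tendsto_atTop.mpr fun b ↦ by
        filter_upwards [eventually_ge_atTop (b + j.natAbs)] with n hn
        omega
    have hlim := tendsto_qPochFin hp
    rw [hE']
    refine ((hlim.comp ha).div ((hlim.comp hb).mul (hlim.comp hc)) (mul_ne_zero hE hE)).congr' ?_
    filter_upwards [eventually_ge_atTop j.natAbs] with n hn
    have hnn : n + n = (j + n).toNat + (-j + n).toNat := by omega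
    rw [if_pos (by omega)]
    simp only [Function.comp_apply, Pi.div_apply]
    nth_rewrite 2 [hnn]
    rw [gaussBinom_eq_div hp, ← hnn]
  · rw [norm_mul]
    gcongr
    split_ifs
    · exact hC _ _
    · simpa using hC0

lemma thetaSeries_reflect (hq0 : q ≠ 0) (hz : z ≠ 0) :
    thetaSeries q z = q / z * thetaSeries q (q ^ 2 / z) := by
  rw [thetaSeries, thetaSeries, ← tsum_mul_left, ← (Equiv.subLeft (-1 : ℤ)).tsum_eq]
  refine tsum_congr fun n ↦ ?_
  have h1 : q ^ ((-1 - n) * (-1 - n)) = q * q ^ (n * n) * (q ^ n) ^ 2 := by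
    rw [← zpow_natCast, ← zpow_mul, ← zpow_one_add₀ hq0, ← zpow_add₀ hq0]
    congr 1
    push_cast
    ring
  have h2 : z ^ (-1 - n) = (z * z ^ n)⁻¹ := by
    rw [← zpow_one_add₀ hz, ← zpow_neg]
    congr 1
    ring
  simp only [Equiv.subLeft_apply]
  rw [h1, h2, div_zpow, ← zpow_natCast q 2, zpow_comm]
  have := zpow_ne_zero n hz
  field_simp
  norm_cast

/-- Pairs of integers are split by the parity of their sum. -/
lemma bijective_parity_split : Function.Bijective
    (Sum.elim (fun ab ↦ (ab.1 + ab.2, ab.1 - ab.2)) fun ab ↦ (ab.1 + ab.2 + 1, ab.1 - ab.2) :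
      (ℤ × ℤ) ⊕ (ℤ × ℤ) → ℤ × ℤ) := by
  constructor
  · rintro (⟨a, b⟩ | ⟨a, b⟩) (⟨c, d⟩ | ⟨c, d⟩) h <;>
      simp only [Sum.elim_inl, Sum.elim_inr, Prod.mk.injEq, Sum.inl.injEq, Sum.inr.injEq,
        reduceCtorEq] at h ⊢ <;> omega
  · rintro ⟨m, n⟩
    rcases Int.even_or_odd' (m + n) with ⟨a, h | h⟩
    · exact ⟨.inl (a, a - n), by simp only [Sum.elim_inl, Prod.mk.injEq]; omega⟩
    · exact ⟨.inr (a, a - n), by simp only [Sum.elim_inr, Prod.mk.injEq]; omega⟩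

lemma hasSum_thetaSeries_mul {w : ℂ} (hq : ‖q‖ < 1) (hq0 : q ≠ 0) (hz : z ≠ 0) (hw : w ≠ 0) :
    HasSum (fun m : ℤ × ℤ ↦ (q ^ (m.1 * m.1) * z ^ m.1) * (q ^ (m.2 * m.2) * w ^ m.2))
      (thetaSeries q z * thetaSeries q w) := by
  have h1 := summable_thetaSeries hq hq0 hz
  have h2 := summable_thetaSeries hq hq0 hw
  have h3 := summable_mul_of_summable_norm h1.norm h2.norm
  have h4 := h3.hasSum
  rwa [← h1.tsum_mul_tsum h2 h3] at h4

/-- The addition formula for products of two theta series. -/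
theorem thetaSeries_mul_thetaSeries {x y : ℂ} (hq : ‖q‖ < 1) (hq0 : q ≠ 0) (hx : x ≠ 0)
    (hy : y ≠ 0) :
    thetaSeries q x * thetaSeries q y =
      thetaSeries (q ^ 2) (x * y) * thetaSeries (q ^ 2) (x / y) +
        q * x * (thetaSeries (q ^ 2) (q ^ 2 * (x * y)) *
          thetaSeries (q ^ 2) (q ^ 2 * (x / y))) := by
  have hp : ‖q ^ 2‖ < 1 := norm_pow_lt_one hq two_ne_zero
  have hp0 : q ^ 2 ≠ 0 := pow_ne_zero 2 hq0
  have hxy := mul_ne_zero hx hy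
  have hxy' := div_ne_zero hx hy
  refine (hasSum_thetaSeries_mul hq hq0 hx hy).unique ?_
  rw [← (Equiv.ofBijective _ bijective_parity_split).hasSum_iff]
  have hsq (n : ℤ) : (q ^ 2) ^ n = (q ^ n) ^ 2 := by
    rw [← zpow_natCast, ← zpow_natCast, zpow_comm]
  refine HasSum.sum ?_ ?_
  · refine (hasSum_thetaSeries_mul hp hp0 hxy hxy').congr_fun fun ⟨a, b⟩ ↦ ?_
    simp only [Function.comp_apply, Equiv.ofBijective_apply, Sum.elim_inl]
    have h1 : q ^ ((a + b) * (a + b)) * q ^ ((a - b) * (a - b)) =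
        (q ^ 2) ^ (a * a) * (q ^ 2) ^ (b * b) := by
      rw [← zpow_add₀ hq0, ← zpow_add₀ hp0, ← zpow_natCast, ← zpow_mul]
      congr 1
      push_cast
      ring
    have h2 : x ^ (a + b) * y ^ (a - b) = (x * y) ^ a * (x / y) ^ b := by
      rw [zpow_add₀ hx, zpow_sub₀ hy, mul_zpow, div_zpow]
      ring
    linear_combination x ^ (a + b) * y ^ (a - b) * h1 +
      (q ^ 2) ^ (a * a) * (q ^ 2) ^ (b * b) * h2
  · refine ((hasSum_thetaSeries_mul hp hp0 (mul_ne_zero hp0 hxy)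
      (mul_ne_zero hp0 hxy')).mul_left (q * x)).congr_fun fun ⟨a, b⟩ ↦ ?_
    simp only [Function.comp_apply, Equiv.ofBijective_apply, Sum.elim_inr]
    have h1 : q ^ ((a + b + 1) * (a + b + 1)) * q ^ ((a - b) * (a - b)) =
        q * ((q ^ 2) ^ (a * a) * (q ^ 2) ^ (b * b) * ((q ^ 2) ^ a * (q ^ 2) ^ b)) := by
      rw [← zpow_add₀ hq0, ← zpow_add₀ hp0, ← zpow_add₀ hp0, ← zpow_add₀ hp0, ← zpow_natCast,
        ← zpow_mul, ← zpow_one_add₀ hq0]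
      congr 1
      push_cast
      ring
    have h2 : x ^ (a + b + 1) * y ^ (a - b) = x * ((x * y) ^ a * (x / y) ^ b) := by
      rw [zpow_add₀ hx, zpow_add₀ hx, zpow_sub₀ hy, mul_zpow, div_zpow, zpow_one]
      ring
    rw [mul_zpow _ (x * y), mul_zpow _ (x / y)]
    linear_combination x ^ (a + b + 1) * y ^ (a - b) * h1 +
      q * ((q ^ 2) ^ (a * a) * (q ^ 2) ^ (b * b) * ((q ^ 2) ^ a * (q ^ 2) ^ b)) * h2

end thetaSeries

section identities

variable {q : ℂ}

/-- With `φ(q) = ∑ q^{n²}` and `ψ(q) = ∑_{n ≥ 0} q^{n(n+1)/2}`, this is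
`φ(-q)² = φ(q²)² - 4 q ψ(q⁴)²`. -/
lemma thetaSeries_neg_one_sq (hq : ‖q‖ < 1) (hq0 : q ≠ 0) :
    thetaSeries q (-1) ^ 2 = thetaSeries (q ^ 2) 1 ^ 2 - q * thetaSeries (q ^ 2) (q ^ 2) ^ 2 := by
  have h := thetaSeries_mul_thetaSeries (x := -1) (y := -1) hq hq0 (by norm_num) (by norm_num)
  norm_num at h
  linear_combination h

lemma thetaSeries_sq_sub_mul_sq (hq : ‖q‖ < 1) (hq0 : q ≠ 0) :
    thetaSeries (q ^ 4) (-q) ^ 2 - q * thetaSeries (q ^ 4) (-q ^ 3) ^ 2 =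
      thetaSeries (q ^ 2) 1 * thetaSeries (q ^ 2) (-q) := by
  have h := thetaSeries_mul_thetaSeries (q := q ^ 2) (x := -q) (y := 1)
    (norm_pow_lt_one hq two_ne_zero) (pow_ne_zero 2 hq0) (neg_ne_zero.mpr hq0) one_ne_zero
  have hr := thetaSeries_reflect (q := q ^ 4) (z := -q ^ 5) (pow_ne_zero 4 hq0)
    (neg_ne_zero.mpr (pow_ne_zero 5 hq0))
  rw [show (q ^ 4) ^ 2 / -q ^ 5 = -q ^ 3 by field_simp,
    show q ^ 4 / -q ^ 5 = -(1 / q) by field_simp] at hr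
  rw [mul_one, div_one, ← pow_mul, show q ^ (2 * 2) * -q = -q ^ 5 by ring, hr] at h
  rw [mul_comm (thetaSeries (q ^ 2) 1), h]
  norm_num
  field_simp
  ring

lemma qPoch_euler_eq (hq : ‖q‖ < 1) : qPoch q q = qPoch q (q ^ 2) * qPoch (q ^ 2) (q ^ 2) := by
  rw [← qPoch_even_mul_odd q hq, ← sq]

lemma thetaSeries_neg_one_eq (hq : ‖q‖ < 1) (hq0 : q ≠ 0) :
    thetaSeries q (-1) = qPoch (q ^ 2) (q ^ 2) * qPoch q (q ^ 2) ^ 2 := by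
  rw [thetaSeries_eq_qPoch hq hq0 (by norm_num)]
  rw [div_neg, neg_neg, div_one, neg_one_mul, neg_neg]
  ring

lemma thetaSeries_self_mul (hq : ‖q‖ < 1) (hq0 : q ≠ 0) :
    thetaSeries q q * qPoch (q ^ 2) (q ^ 2) = 2 * qPoch (q ^ 4) (q ^ 4) ^ 2 := by
  have h2 := norm_pow_lt_one hq two_ne_zero
  have h3 := qPoch_mul_qPoch_neg (q ^ 2) h2
  rw [← pow_mul] at h3
  rw [thetaSeries_eq_qPoch hq hq0 hq0, div_self hq0, qPoch_eq_mul (-1) h2, ← h3, neg_one_mul,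
    ← sq]
  ring

lemma thetaSeries_neg_eq (hq : ‖q‖ < 1) (hq0 : q ≠ 0) :
    thetaSeries (q ^ 2) (-q) = qPoch (q ^ 4) (q ^ 4) * qPoch q (q ^ 2) := by
  have h2 := norm_pow_lt_one hq two_ne_zero
  rw [thetaSeries_eq_qPoch h2 (pow_ne_zero 2 hq0) (neg_ne_zero.mpr hq0),
    ← qPoch_even_mul_odd q h2, ← pow_mul, show -(q ^ 2 / -q) = q by field_simp,
    show -(-q * q ^ 2) = q * q ^ 2 by ring]
  ring

lemma thetaSeries_pow_four_neg_eq (hq : ‖q‖ < 1) (hq0 : q ≠ 0) :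
    thetaSeries (q ^ 4) (-q) =
      qPoch (q ^ 8) (q ^ 8) * (qPoch (q ^ 5) (q ^ 8) * qPoch (q ^ 3) (q ^ 8)) := by
  rw [thetaSeries_eq_qPoch (norm_pow_lt_one hq four_ne_zero) (pow_ne_zero 4 hq0)
    (neg_ne_zero.mpr hq0), ← pow_mul, show -(q ^ 4 / -q) = q ^ 3 by field_simp,
    show -(-q * q ^ 4) = q ^ 5 by ring]

lemma thetaSeries_pow_four_neg_cube_eq (hq : ‖q‖ < 1) (hq0 : q ≠ 0) :
    thetaSeries (q ^ 4) (-q ^ 3) =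
      qPoch (q ^ 8) (q ^ 8) * (qPoch (q ^ 7) (q ^ 8) * qPoch q (q ^ 8)) := by
  rw [thetaSeries_eq_qPoch (norm_pow_lt_one hq four_ne_zero) (pow_ne_zero 4 hq0)
    (neg_ne_zero.mpr (pow_ne_zero 3 hq0)), ← pow_mul, show -(q ^ 4 / -q ^ 3) = q by field_simp,
    show -(-q ^ 3 * q ^ 4) = q ^ 7 by ring]

lemma qPoch_mul_qPoch_add_four (n : ℕ) (hq : ‖q‖ < 1) :
    qPoch (q ^ n) (q ^ 8) * qPoch (q ^ (n + 4)) (q ^ 8) = qPoch (q ^ n) (q ^ 4) := by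
  rw [← qPoch_even_mul_odd (q ^ n) (norm_pow_lt_one hq four_ne_zero), ← pow_mul, pow_add]

lemma qPoch_odd_eq (hq : ‖q‖ < 1) :
    (qPoch (q ^ 7) (q ^ 8) * qPoch q (q ^ 8)) * (qPoch (q ^ 5) (q ^ 8) * qPoch (q ^ 3) (q ^ 8)) =
      qPoch q (q ^ 2) := by
  have h1 := qPoch_mul_qPoch_add_four 1 hq
  have h3 := qPoch_mul_qPoch_add_four 3 hq
  have h := qPoch_even_mul_odd q (norm_pow_lt_one hq two_ne_zero)
  rw [← pow_mul, ← pow_succ'] at h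
  norm_num at h1 h3 h
  rw [← h, ← h1, ← h3]
  ring

theorem qPoch_quartic_relation (hq : ‖q‖ < 1) (hq0 : q ≠ 0) :
    let A := qPoch (q ^ 7) (q ^ 8) * qPoch q (q ^ 8)
    let B := qPoch (q ^ 5) (q ^ 8) * qPoch (q ^ 3) (q ^ 8)
    (B ^ 4 - 6 * q * A ^ 2 * B ^ 2 + q ^ 2 * A ^ 4) * qPoch (q ^ 2) (q ^ 2) ^ 2 *
      qPoch (q ^ 8) (q ^ 8) ^ 4 = A ^ 2 * B ^ 2 * qPoch q q ^ 4 * qPoch (q ^ 4) (q ^ 4) ^ 2 := by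
  intro A B
  have hAB : A * B = qPoch q (q ^ 2) := qPoch_odd_eq hq
  have h1 := thetaSeries_sq_sub_mul_sq hq hq0
  have h2 := thetaSeries_neg_one_sq hq hq0
  have h3 := thetaSeries_self_mul (norm_pow_lt_one hq two_ne_zero) (pow_ne_zero 2 hq0)
  rw [← pow_mul, ← pow_mul] at h3
  norm_num at h3
  rw [thetaSeries_pow_four_neg_eq hq hq0, thetaSeries_pow_four_neg_cube_eq hq hq0,
    thetaSeries_neg_eq hq hq0] at h1
  rw [thetaSeries_neg_one_eq hq hq0] at h2
  rw [qPoch_euler_eq hq]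
  change (qPoch (q ^ 8) (q ^ 8) * B) ^ 2 - q * (qPoch (q ^ 8) (q ^ 8) * A) ^ 2 = _ at h1
  rw [← hAB] at h1 h2 ⊢
  set E₂ := qPoch (q ^ 2) (q ^ 2)
  set E₄ := qPoch (q ^ 4) (q ^ 4)
  set E₈ := qPoch (q ^ 8) (q ^ 8)
  set φ := thetaSeries (q ^ 2) 1
  set ψ := thetaSeries (q ^ 2) (q ^ 2)
  have h1' : E₈ ^ 4 * (B ^ 2 - q * A ^ 2) ^ 2 = φ ^ 2 * (E₄ * (A * B)) ^ 2 := by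
    linear_combination (E₈ ^ 2 * (B ^ 2 - q * A ^ 2) + φ * (E₄ * (A * B))) * h1
  have h3' : ψ ^ 2 * E₄ ^ 2 = 4 * E₈ ^ 4 := by
    linear_combination (ψ * E₄ + 2 * E₈ ^ 2) * h3
  linear_combination E₂ ^ 2 * h1' - E₂ ^ 2 * E₄ ^ 2 * (A * B) ^ 2 * h2 +
    q * E₂ ^ 2 * (A * B) ^ 2 * h3'

end identities

lemma qpow_natCast (τ : ℂ) (n : ℕ) : qpow τ n = qpow τ 1 ^ n := by
  rw [qpow, qpow, ← Complex.exp_nat_mul]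
  congr 1
  push_cast
  ring

lemma norm_qpow_one_lt_one {τ : ℂ} (hτ : 0 < τ.im) : ‖qpow τ 1‖ < 1 := by
  simpa [qpow] using UpperHalfPlane.norm_exp_two_pi_I_lt_one ⟨τ, hτ⟩

lemma dedekindEta_natCast_mul (τ : ℂ) (k : ℕ) :
    dedekindEta (k * τ) = qpow τ (1 / 24) ^ k * qPoch (qpow τ 1 ^ k) (qpow τ 1 ^ k) := by
  have h (r : ℝ) : qpow (k * τ) r = qpow τ r ^ k := by
    rw [qpow, qpow, ← Complex.exp_nat_mul]
    congr 1
    ring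
  rw [dedekindEta, h, qPoch]
  congr 1
  refine tprod_congr fun n ↦ ?_
  rw [h, ← Nat.cast_add_one, qpow_natCast]
  ring

lemma vRam_eq {τ : ℂ} (hτ : 0 < τ.im) :
    vRam τ = qpow τ (1 / 2) * ((qPoch (qpow τ 1 ^ 7) (qpow τ 1 ^ 8) *
      qPoch (qpow τ 1) (qpow τ 1 ^ 8)) / (qPoch (qpow τ 1 ^ 5) (qpow τ 1 ^ 8) *
      qPoch (qpow τ 1 ^ 3) (qpow τ 1 ^ 8))) := by
  have hq := norm_qpow_one_lt_one hτ
  rw [vRam]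
  have hf (n : ℕ) : (1 - qpow τ ((n : ℝ) + 1)) ^ chi8 (n + 1) =
      (1 - qpow τ 1 ^ (n + 1)) ^ chi8 (n + 1) := by
    rw [← Nat.cast_add_one, qpow_natCast]
  simp_rw [hf]
  set q := qpow τ 1
  have h8 := norm_pow_lt_one hq (n := 8) (by norm_num)
  have hpos (a : ℕ) (ha : ∀ k : ℕ, chi8 (8 * k + a) = 1) :
      HasProd (fun k : ℕ ↦ (1 - q ^ (8 * k + a)) ^ chi8 (8 * k + a))
        (qPoch (q ^ a) (q ^ 8)) := by
    convert hasProd_qPoch (q ^ a) h8 using 2 with k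
    rw [ha, zpow_one]
    ring
  have hneg (a : ℕ) (ha0 : a ≠ 0) (ha : ∀ k : ℕ, chi8 (8 * k + a) = -1) :
      HasProd (fun k : ℕ ↦ (1 - q ^ (8 * k + a)) ^ chi8 (8 * k + a))
        (qPoch (q ^ a) (q ^ 8))⁻¹ := by
    refine ((hasProd_qPoch (q ^ a) h8).inv₀
      (qPoch_ne_zero (norm_pow_lt_one hq ha0) h8)).congr_fun fun k ↦ ?_
    rw [ha, zpow_neg_one]
    ring
  have h1 := hpos 1 fun k ↦ if_pos (by omega)
  have h7 := hpos 7 fun k ↦ if_pos (by omega)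
  have h3 := hneg 3 (by norm_num) fun k ↦ by rw [chi8, if_neg (by omega), if_pos (by omega)]
  have h5 := hneg 5 (by norm_num) fun k ↦ by rw [chi8, if_neg (by omega), if_pos (by omega)]
  have h0 : HasProd (fun k : ℕ ↦ (1 - q ^ (2 * k + 1 + 1)) ^ chi8 (2 * k + 1 + 1)) 1 := by
    convert hasProd_one with k
    rw [chi8, if_neg (by omega), if_neg (by omega), zpow_zero]
  let f : ℕ → ℂ := fun n ↦ (1 - q ^ (n + 1)) ^ chi8 (n + 1)
  have h15 : HasProd (fun k ↦ f (2 * (2 * k))) (qPoch (q ^ 1) (q ^ 8) * (qPoch (q ^ 5) (q ^ 8))⁻¹) :=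
    HasProd.even_mul_odd (f := fun k ↦ f (2 * (2 * k)))
      (by convert h1 using 1; ext k; simp only [f]; congr! 2 <;> ring_nf)
      (by convert h5 using 1; ext k; simp only [f]; congr! 2 <;> ring_nf)
  have h37 : HasProd (fun k ↦ f (2 * (2 * k + 1)))
      ((qPoch (q ^ 3) (q ^ 8))⁻¹ * qPoch (q ^ 7) (q ^ 8)) :=
    HasProd.even_mul_odd (f := fun k ↦ f (2 * (2 * k + 1)))
      (by convert h3 using 1; ext k; simp only [f]; congr! 2 <;> ring_nf)
      (by convert h7 using 1; ext k; simp only [f]; congr! 2 <;> ring_nf)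
  have hodd := HasProd.even_mul_odd (f := fun k ↦ f (2 * k)) h15 h37
  rw [(HasProd.even_mul_odd (f := f) hodd h0).tprod_eq, pow_one, div_eq_mul_inv (_ * _), mul_inv]
  ring

/-- If `τ` lies in the upper half-plane, then
`(1 - 6v(τ)² + v(τ)⁴)·η(2τ)²·η(8τ)⁴ = v(τ)²·η(τ)⁴·η(4τ)²`, i.e.
`v(τ)⁻² + v(τ)² - 6 = η(τ)⁴η(4τ)²/(η(2τ)²η(8τ)⁴)`. -/
theorem v_eta_relation (τ : ℂ) (hτ : 0 < τ.im) :
    (1 - 6 * vRam τ ^ 2 + vRam τ ^ 4) * dedekindEta (2 * τ) ^ 2 * dedekindEta (8 * τ) ^ 4 =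
      vRam τ ^ 2 * dedekindEta τ ^ 4 * dedekindEta (4 * τ) ^ 2 := by
  have hq := norm_qpow_one_lt_one hτ
  have hq0 : qpow τ 1 ≠ 0 := Complex.exp_ne_zero _
  have hroot (n : ℕ) : qpow τ (1 / 24) ^ n = qpow τ (n / 24) := by
    rw [qpow, qpow, ← Complex.exp_nat_mul]
    congr 1
    push_cast
    ring
  have hr24 : qpow τ 1 = qpow τ (1 / 24) ^ 24 := by
    rw [hroot]; norm_num
  have hr12 : qpow τ (1 / 2) = qpow τ (1 / 24) ^ 12 := by
    rw [hroot]; norm_num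
  have e1 := dedekindEta_natCast_mul τ 1
  have e2 := dedekindEta_natCast_mul τ 2
  have e4 := dedekindEta_natCast_mul τ 4
  have e8 := dedekindEta_natCast_mul τ 8
  push_cast at e1 e2 e4 e8
  rw [one_mul, pow_one, pow_one] at e1
  have key := qPoch_quartic_relation hq hq0
  have h8 := norm_pow_lt_one hq (n := 8) (by norm_num)
  have hB : qPoch (qpow τ 1 ^ 5) (qpow τ 1 ^ 8) * qPoch (qpow τ 1 ^ 3) (qpow τ 1 ^ 8) ≠ 0 :=
    mul_ne_zero (qPoch_ne_zero (norm_pow_lt_one hq (by norm_num)) h8)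
      (qPoch_ne_zero (norm_pow_lt_one hq (by norm_num)) h8)
  rw [e1, e2, e4, e8, vRam_eq hτ, hr12]
  simp only at key
  set A := qPoch (qpow τ 1 ^ 7) (qpow τ 1 ^ 8) * qPoch (qpow τ 1) (qpow τ 1 ^ 8)
  set B := qPoch (qpow τ 1 ^ 5) (qpow τ 1 ^ 8) * qPoch (qpow τ 1 ^ 3) (qpow τ 1 ^ 8)
  set E₁ := qPoch (qpow τ 1) (qpow τ 1)
  set E₂ := qPoch (qpow τ 1 ^ 2) (qpow τ 1 ^ 2)
  set E₄ := qPoch (qpow τ 1 ^ 4) (qpow τ 1 ^ 4)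
  set E₈ := qPoch (qpow τ 1 ^ 8) (qpow τ 1 ^ 8)
  clear_value A B E₁ E₂ E₄ E₈
  rw [hr24] at key
  generalize qpow τ (1 / 24) = r at *
  field_simp
  linear_combination r ^ 36 * key
end
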